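/- arXiv:2107.01534 — 7 statements merged into one kernel-verified Lean document; each statement's English description precedes it below -/
import Mathlib

section
/- Let K be a field and S = S_1 × ⋯ × S_m ⊆ K^m a Cartesian product of finite subsets S_i ⊆ K with n_i = |S_i| ≥ 1. Let A ⊆ ∏_{i=1}^m {0,…,n_i−1} be closed under divisibility (if a ∈ A and b ∈ ℤ_{≥0}^m satisfies b_i ≤ a_i for all i, then b ∈ A). If a ∈ A and b ∈ A^∁_S := {(n_1−1−c_1,…,n_m−1−c_m) : c ∈ ∏_{i=1}^m {0,…,n_i−1}, c ∉ A}, then ∑_{s ∈ S} λ_s s_1^{a_1+b_1}⋯s_m^{a_m+b_m} = 0; that is, the vector (λ_s s^b)_{s∈S} is orthogonal to the vector (s^a)_{s∈S} under the standard bilinear form on K^S. -/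
/-- The sum of the residues of `x ^ k / ∏ u ∈ T, (x - u)` vanishes when `k + 1 < |T|`. -/
theorem sum_inv_prod_erase_sub_mul_pow_eq_zero {K : Type*} [Field K] [DecidableEq K]
    (T : Finset K) {k : ℕ} (hk : k + 1 < T.card) :
    ∑ x ∈ T, (∏ u ∈ T.erase x, (x - u))⁻¹ * x ^ k = 0 := by
  have hdeg : (Polynomial.X ^ k : Polynomial K).degree < T.card := by
    rw [Polynomial.degree_X_pow]
    exact_mod_cast (by omega : k < T.card)
  have h := Lagrange.coeff_eq_sum (s := T) (v := id) Function.injective_id.injOn hdeg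
  rw [Polynomial.coeff_X_pow, if_neg (by omega)] at h
  rw [h]
  refine Finset.sum_congr rfl fun x _ => ?_
  simp [div_eq_mul_inv, mul_comm]

/-- Let `S = S_1 × ⋯ × S_m ⊆ K^m` with `n_i = |S_i| ≥ 1` and let
`A ⊆ ∏_i {0,…,n_i−1}` be closed under divisibility.  If `a ∈ A` and
`b ∈ A^∁_S` (i.e. `b` lies in the box and `(n_1−1−b_1,…,n_m−1−b_m) ∉ A`), then
`∑_{s ∈ S} λ_s s^{a+b} = 0`, i.e. the residue vector `(λ_s s^b)_s` is orthogonal to the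
evaluation vector `(s^a)_s`. -/
theorem residue_orthogonal_of_decreasing {K : Type*} [Field K] [DecidableEq K] {m : ℕ}
    (S : Fin m → Finset K) (hS : ∀ i, 1 ≤ (S i).card)
    (A : Set (Fin m → ℕ))
    (hbox : ∀ a ∈ A, ∀ i, a i < (S i).card)
    (hdiv : ∀ a ∈ A, ∀ b : Fin m → ℕ, (∀ i, b i ≤ a i) → b ∈ A)
    (a : Fin m → ℕ) (ha : a ∈ A)
    (b : Fin m → ℕ) (hb1 : ∀ i, b i < (S i).card)
    (hb2 : (fun i => (S i).card - 1 - b i) ∉ A) :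
    ∑ s ∈ Fintype.piFinset S,
      ((∏ i, ∏ u ∈ (S i).erase (s i), (s i - u))⁻¹ * ∏ i, s i ^ b i) * (∏ i, s i ^ a i) = 0 := by
  obtain ⟨i, hi⟩ : ∃ i, a i < (S i).card - 1 - b i := by
    by_contra! h
    exact hb2 (hdiv a ha _ h)
  calc
    _ = ∑ s ∈ Fintype.piFinset S,
          ∏ j, ((∏ u ∈ (S j).erase (s j), (s j - u))⁻¹ * s j ^ (b j + a j)) := by
      refine Finset.sum_congr rfl fun s _ => ?_
      simp only [← Finset.prod_inv_distrib, ← Finset.prod_mul_distrib, pow_add, mul_assoc]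
    _ = ∏ j, ∑ x ∈ S j, (∏ u ∈ (S j).erase x, (x - u))⁻¹ * x ^ (b j + a j) :=
      (Finset.prod_univ_sum S
        fun j x => (∏ u ∈ (S j).erase x, (x - u))⁻¹ * x ^ (b j + a j)).symm
    _ = 0 := Finset.prod_eq_zero (Finset.mem_univ i)
      (sum_inv_prod_erase_sub_mul_pow_eq_zero (S i) (by omega))
end

section
/- Let K be a field and S = S_1 × ⋯ × S_m ⊆ K^m a Cartesian product of finite subsets S_i ⊆ K with n_i = |S_i| ≥ 1. Let A ⊆ ∏_{i=1}^m {0,…,n_i−1} be a finite set. Then the evaluation vectors ev_S(x^a) = (s^a)_{s∈S} ∈ K^S, for a ∈ A, are K-linearly independent; consequently the monomial-Cartesian code C(S,A) = Span_K{ev_S(x^a) : a ∈ A} has K-dimension |A|. -/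
/-- Monomials whose exponents lie in the box `∏ i, {0, …, |S i| - 1}` have linearly independent
restrictions to the grid `∏ i, S i`. -/
theorem linearIndependent_monomialEval {R σ : Type*} [CommRing R] [IsDomain R] [Fintype σ]
    [DecidableEq σ] (S : σ → Finset R) (hS : ∀ i, 1 ≤ (S i).card) (A : Finset (σ → ℕ))
    (hbox : ∀ a ∈ A, ∀ i, a i < (S i).card) :
    LinearIndependent R
      (fun a : A => fun s : {x : σ → R // x ∈ Fintype.piFinset S} => ∏ i, s.1 i ^ (a.1 i)) := by
  rw [Fintype.linearIndependent_iff]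
  intro g hg
  let e : (σ → ℕ) → (σ →₀ ℕ) := Finsupp.equivFunOnFinite.symm
  have he : Function.Injective e := Finsupp.equivFunOnFinite.symm.injective
  let P : MvPolynomial σ R := ∑ a : A, MvPolynomial.monomial (e a) (g a)
  have hP : P = 0 := by
    refine MvPolynomial.eq_zero_of_eval_zero_at_prod_finset P S (fun i => ?_) fun x hx => ?_
    · rw [MvPolynomial.degreeOf_lt_iff (hS i)]
      intro d hd
      obtain ⟨a, -, ha⟩ := Finset.mem_biUnion.mp (MvPolynomial.support_sum hd)
      rw [Finset.mem_singleton.mp (MvPolynomial.support_monomial_subset ha)]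
      exact hbox a a.2 i
    · have h := congrFun hg ⟨x, Fintype.mem_piFinset.mpr hx⟩
      simpa [P, e, MvPolynomial.eval_monomial, Finsupp.prod_fintype] using h
  intro a
  have h := congrArg (MvPolynomial.coeff (e a)) hP
  simpa [P, MvPolynomial.coeff_sum, MvPolynomial.coeff_monomial, he.eq_iff, Subtype.val_inj]
    using h

/-- For a Cartesian product `S = S_1 × ⋯ × S_m ⊆ K^m` of nonempty finite subsets and a finite
set `A ⊆ ∏_i {0,…,n_i−1}` of exponent vectors, the evaluation vectors
`ev_S(x^a) = (s^a)_{s ∈ S}`, `a ∈ A`, are `K`-linearly independent; consequently the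
monomial-Cartesian code `C(S,A) = Span_K{ev_S(x^a) : a ∈ A}` has dimension `|A|`. -/
theorem monomialCartesianCode_linearIndependent_and_dim {K : Type*} [Field K] {m : ℕ}
    (S : Fin m → Finset K) (hS : ∀ i, 1 ≤ (S i).card)
    (A : Finset (Fin m → ℕ)) (hbox : ∀ a ∈ A, ∀ i, a i < (S i).card) :
    LinearIndependent K
      (fun a : A => fun s : {x : Fin m → K // x ∈ Fintype.piFinset S} =>
        ∏ i, s.1 i ^ (a.1 i)) ∧
    Module.finrank K
      (Submodule.span K (Set.range
        (fun a : A => fun s : {x : Fin m → K // x ∈ Fintype.piFinset S} =>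
          ∏ i, s.1 i ^ (a.1 i)))) = A.card := by
  have hli := linearIndependent_monomialEval S hS A hbox
  exact ⟨hli, by rw [finrank_span_eq_card hli, Fintype.card_coe]⟩
end

section
/- Let K be a field and S = S_1 × ⋯ × S_m ⊆ K^m a Cartesian product of finite subsets S_i ⊆ K with n_i = |S_i| ≥ 1. Let A ⊆ ∏_{i=1}^m {0,…,n_i−1} be closed under divisibility (if a ∈ A and b_i ≤ a_i for all i then b ∈ A). Then the orthogonal complement of the monomial-Cartesian code C(S,A) in K^S with respect to the standard bilinear form equals the K-span of the vectors (λ_s s^b)_{s∈S} for b ∈ A^∁_S; i.e., C(S,A)^⊥ = D_S · C(S, A^∁_S), where D_S is the diagonal operator multiplying the coordinate at s by λ_s. -/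
/-- The Lagrange weights of a finite set `s` pair to zero with `x ^ k` for `k < #s - 1` and to one
for `k = #s - 1`. -/
theorem sum_inv_prod_sub_mul_pow {K : Type*} [Field K] [DecidableEq K] (s : Finset K) {k : ℕ}
    (hk : k < s.card) :
    ∑ x ∈ s, (∏ u ∈ s.erase x, (x - u))⁻¹ * x ^ k = if k = s.card - 1 then 1 else 0 := by
  have h := Lagrange.coeff_eq_sum (s := s) (v := id) Function.injective_id.injOn
    (P := Polynomial.X ^ k) (by rw [Polynomial.degree_X_pow]; exact_mod_cast hk)
  simp only [Polynomial.coeff_X_pow, Polynomial.eval_pow, Polynomial.eval_X, id] at h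
  simp_rw [eq_comm (a := k), h, div_eq_inv_mul]

/-- The vector `(λ_s s^b)_{s ∈ S}`. -/
def residueVector {K ι : Type*} [Field K] [DecidableEq K] [Fintype ι] [DecidableEq ι]
    (S : ι → Finset K) (b : ι → ℕ) : {x : ι → K // x ∈ Fintype.piFinset S} → K :=
  fun s => (∏ i, ∏ u ∈ (S i).erase (s.1 i), (s.1 i - u))⁻¹ * ∏ i, s.1 i ^ b i

section ResidueVector

variable {K ι : Type*} [Field K] [DecidableEq K] [Fintype ι] [DecidableEq ι] {S : ι → Finset K}

theorem sum_residueVector_mul (b a : ι → ℕ) :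
    ∑ s : {x // x ∈ Fintype.piFinset S}, residueVector S b s * ∏ i, s.1 i ^ a i =
      ∏ i, ∑ x ∈ S i, (∏ u ∈ (S i).erase x, (x - u))⁻¹ * x ^ (b i + a i) := by
  rw [Finset.prod_univ_sum, ← Finset.sum_coe_sort (Fintype.piFinset S)]
  refine Finset.sum_congr rfl fun s _ => ?_
  simp only [residueVector, pow_add, Finset.prod_mul_distrib, Finset.prod_inv_distrib, mul_assoc]

theorem sum_residueVector_mul_eq_zero {b a : ι → ℕ} (h : ∃ i, b i + a i < (S i).card - 1) :
    ∑ s : {x // x ∈ Fintype.piFinset S}, residueVector S b s * ∏ i, s.1 i ^ a i = 0 := by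
  obtain ⟨i, hi⟩ := h
  rw [sum_residueVector_mul]
  refine Finset.prod_eq_zero (Finset.mem_univ i) ?_
  rw [sum_inv_prod_sub_mul_pow _ (by omega), if_neg hi.ne]

theorem sum_residueVector_mul_eq_one {b : ι → ℕ} (hb : ∀ i, b i < (S i).card) :
    ∑ s : {x // x ∈ Fintype.piFinset S}, residueVector S b s *
      ∏ i, s.1 i ^ ((S i).card - 1 - b i) = 1 := by
  rw [sum_residueVector_mul b fun i => (S i).card - 1 - b i]
  refine Finset.prod_eq_one fun i _ => ?_
  have := hb i
  rw [sum_inv_prod_sub_mul_pow _ (by omega), if_pos (by omega)]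

/-- If a combination of residue vectors is orthogonal to the monomials of a divisibility-closed
set `A`, then its coefficients at the complements of elements of `A` vanish. -/
theorem coeff_eq_zero_of_orthogonal {A : Set (ι → ℕ)}
    (hdiv : ∀ a ∈ A, ∀ b : ι → ℕ, (∀ i, b i ≤ a i) → b ∈ A)
    (f : ((i : ι) → Fin (S i).card) → K)
    (hf : ∀ a ∈ A, ∑ s, (∑ b, f b * residueVector S (fun i => b i) s) * ∏ i, s.1 i ^ a i = 0)
    (b : (i : ι) → Fin (S i).card) (hb : (fun i => (S i).card - 1 - b i) ∈ A) : f b = 0 := by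
  induction hN : ∑ i, ((S i).card - 1 - (b i : ℕ)) using Nat.strong_induction_on generalizing b with
  | _ N ih =>
  subst hN
  have key := hf _ hb
  simp_rw [Finset.sum_mul, mul_assoc] at key
  rw [Finset.sum_comm] at key
  simp_rw [← Finset.mul_sum] at key
  rw [Finset.sum_eq_single b, sum_residueVector_mul_eq_one fun i => (b i).2, mul_one] at key
  · exact key
  · intro c _ hcb
    by_cases hlt : ∃ i, (c i : ℕ) < b i
    · rw [sum_residueVector_mul_eq_zero (a := fun i => (S i).card - 1 - b i), mul_zero]
      obtain ⟨i, hi⟩ := hlt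
      exact ⟨i, by have := (b i).2; omega⟩
    · push Not at hlt
      rw [ih _ _ c _ rfl, zero_mul]
      · obtain ⟨j, hj⟩ := Function.ne_iff.1 hcb
        have hj' : (c j : ℕ) ≠ b j := fun h => hj (Fin.ext h)
        refine Finset.sum_lt_sum (fun i _ => Nat.sub_le_sub_left (hlt i) _)
          ⟨j, Finset.mem_univ j, ?_⟩
        have := hlt j
        have := (c j).2
        omega
      · exact hdiv _ hb _ fun i => Nat.sub_le_sub_left (hlt i) _
  · simp

theorem span_residueVector_eq_top :
    Submodule.span K (Set.range fun b : (i : ι) → Fin (S i).card =>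
      residueVector S fun i => b i) = ⊤ := by
  refine LinearIndependent.span_eq_top_of_card_eq_finrank' ?_ (by simp)
  rw [Fintype.linearIndependent_iff]
  intro f hf b
  refine coeff_eq_zero_of_orthogonal (A := Set.univ) (by simp) f (fun a _ => ?_) b trivial
  refine Finset.sum_eq_zero fun s _ => ?_
  have h := congrFun hf s
  simp only [Finset.sum_apply, Pi.smul_apply, smul_eq_mul, Pi.zero_apply] at h
  rw [h, zero_mul]

end ResidueVector


/-- For a decreasing monomial-Cartesian code `C(S,A)` (with `A` inside the box and closed under
divisibility), the dual code — the orthogonal complement w.r.t. the standard bilinear form on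
`K^S` — equals the span of the residue vectors `(λ_s s^b)_{s ∈ S}` for `b ∈ A^∁_S`,
i.e. `C(S,A)^⊥ = D_S · C(S, A^∁_S)`. -/
theorem dual_decreasing_monomialCartesianCode {K : Type*} [Field K] [DecidableEq K] {m : ℕ}
    (S : Fin m → Finset K) (hS : ∀ i, 1 ≤ (S i).card)
    (A : Set (Fin m → ℕ))
    (hbox : ∀ a ∈ A, ∀ i, a i < (S i).card)
    (hdiv : ∀ a ∈ A, ∀ b : Fin m → ℕ, (∀ i, b i ≤ a i) → b ∈ A) :
    {v : {x : Fin m → K // x ∈ Fintype.piFinset S} → K |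
        ∀ c ∈ Submodule.span K
          ((fun a : Fin m → ℕ => fun s : {x : Fin m → K // x ∈ Fintype.piFinset S} =>
              ∏ i, s.1 i ^ a i) '' A),
          ∑ s, v s * c s = 0}
      = ↑(Submodule.span K
          ((fun b : Fin m → ℕ => fun s : {x : Fin m → K // x ∈ Fintype.piFinset S} =>
              (∏ i, ∏ u ∈ (S i).erase (s.1 i), (s.1 i - u))⁻¹ * ∏ i, s.1 i ^ b i) ''
            {b : Fin m → ℕ | (∀ i, b i < (S i).card) ∧
              (fun i => (S i).card - 1 - b i) ∉ A})) := by
  ext v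
  simp only [Set.mem_ofPred_eq, SetLike.mem_coe]
  change _ ↔ v ∈ Submodule.span K (residueVector S '' _)
  constructor
  · intro hv
    obtain ⟨f, rfl⟩ := (Submodule.mem_span_range_iff_exists_fun K).1
      (span_residueVector_eq_top (S := S) ▸ Submodule.mem_top (x := v))
    refine Submodule.sum_mem _ fun b _ => ?_
    by_cases hb : (fun i => (S i).card - 1 - (b i : ℕ)) ∈ A
    · rw [coeff_eq_zero_of_orthogonal hdiv f (fun a ha => ?_) b hb, zero_smul]
      · exact Submodule.zero_mem _
      · simpa using hv _ (Submodule.subset_span ⟨a, ha, rfl⟩)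
    · exact Submodule.smul_mem _ _ (Submodule.subset_span ⟨_, ⟨fun i => (b i).2, hb⟩, rfl⟩)
  · intro hv c hc
    change v ⬝ᵥ c = 0
    induction hv, hc using Submodule.span_induction₂ with
    | mem_mem v c hv hc =>
      obtain ⟨b, ⟨hb, hbA⟩, rfl⟩ := hv
      obtain ⟨a, ha, rfl⟩ := hc
      refine sum_residueVector_mul_eq_zero ?_
      by_contra! h
      exact hbA (hdiv a ha _ fun i => by have := h i; omega)
    | zero_left => simp
    | zero_right => simp
    | add_left _ _ _ _ _ _ h₁ h₂ => rw [add_dotProduct, h₁, h₂, add_zero]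
    | add_right _ _ _ _ _ _ h₁ h₂ => rw [dotProduct_add, h₁, h₂, add_zero]
    | smul_left _ _ _ _ _ h => rw [smul_dotProduct, h, smul_zero]
    | smul_right _ _ _ _ _ h => rw [dotProduct_smul, h, smul_zero]
end

section
/- Let K be a field and S = S_1 × ⋯ × S_m ⊆ K^m a Cartesian product of finite subsets S_i ⊆ K with n_i = |S_i| ≥ 1, and let k_1,…,k_m be integers with 0 ≤ k_i ≤ n_i. Let A_Car1(k) = ∏_{i=1}^m {0,…,n_i−1} \ ∏_{i=1}^m {k_i,…,n_i−1} and let ACar1(S,k) = C(S, A_Car1(k)). Then the orthogonal complement of ACar1(S,k) in K^S with respect to the standard bilinear form equals the K-span of the vectors (λ_s s^b)_{s∈S} for b ∈ ∏_{i=1}^m {0,…,n_i−k_i−1}. -/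
open Polynomial in
/-- The coefficients of `∏_{u ∈ S \ {t}} (X - u)` are polynomials in `t`, whose coefficients are
those of `∏_{u ∈ S} (X - u)`. -/
theorem coeff_prod_erase_X_sub_C {K : Type*} [Field K] [DecidableEq K] (S : Finset K) {t : K}
    (ht : t ∈ S) {b : ℕ} (hb : b ≤ S.card) :
    (∏ u ∈ S.erase t, (X - C u)).coeff b =
      ∑ j ∈ Finset.range (S.card - b), (∏ u ∈ S, (X - C u)).coeff (j + b + 1) * t ^ j := by
  have hM : (∏ u ∈ S.erase t, (X - C u)).coeff S.card = 0 := by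
    apply coeff_eq_zero_of_natDegree_lt
    rw [natDegree_finsetProd_X_sub_C_eq_card]
    exact Finset.card_erase_lt_of_mem ht
  rw [← Finset.mul_prod_erase S _ ht]
  generalize (∏ u ∈ S.erase t, (X - C u)) = M at hM
  have h : ∀ j ∈ Finset.range (S.card - b), ((X - C t) * M).coeff (j + b + 1) * t ^ j =
      M.coeff (j + b) * t ^ j - M.coeff (j + 1 + b) * t ^ (j + 1) := by
    intro j _
    rw [sub_mul, coeff_sub, coeff_X_mul, coeff_C_mul, add_right_comm j b 1]
    ring
  rw [Finset.sum_congr rfl h, Finset.sum_range_sub' (fun j => M.coeff (j + b) * t ^ j),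
    Nat.sub_add_cancel hb, hM]
  simp

open Polynomial in
theorem sum_inv_prod_erase_mul_pow_eq_zero {K : Type*} [Field K] [DecidableEq K] (S : Finset K)
    {d : ℕ} (hd : d + 1 < S.card) :
    ∑ t ∈ S, (∏ u ∈ S.erase t, (t - u))⁻¹ * t ^ d = 0 := by
  have h := Lagrange.coeff_eq_sum (s := S) (v := id) (P := (X ^ d : K[X]))
    Function.injective_id.injOn (by rw [degree_X_pow]; exact_mod_cast (by omega : d < S.card))
  rw [coeff_X_pow, if_neg (by omega)] at h
  rw [h]
  refine Finset.sum_congr rfl fun t _ => ?_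
  simp [div_eq_inv_mul]

open Polynomial in
theorem sum_coeff_prod_erase_mul_pow {K : Type*} [Field K] [DecidableEq K] (S : Finset K) {t : K}
    (ht : t ∈ S) (s : K) :
    ∑ b ∈ Finset.range S.card, (∏ u ∈ S.erase t, (X - C u)).coeff b * s ^ b =
      ∏ u ∈ S.erase t, (s - u) := by
  rw [← eval_eq_sum_range' (p := ∏ u ∈ S.erase t, (X - C u)), eval_prod]
  · simp
  · rw [natDegree_finsetProd_X_sub_C_eq_card]
    exact Finset.card_erase_lt_of_mem ht


/-- The dual of the augmented Cartesian code 1, `ACar1(S,k) = C(S, A_Car1(k))` with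
`A_Car1(k) = ∏_i {0,…,n_i−1} \ ∏_i {k_i,…,n_i−1}` and `0 ≤ k_i ≤ n_i = |S_i|`, equals
the span of the residue vectors `(λ_s s^b)_{s ∈ S}` for `b ∈ ∏_i {0,…,n_i−k_i−1}`. -/
theorem dual_ACar1 {K : Type*} [Field K] [DecidableEq K] {m : ℕ}
    (S : Fin m → Finset K) (hS : ∀ i, 1 ≤ (S i).card)
    (k : Fin m → ℕ) (hk : ∀ i, k i ≤ (S i).card) :
    {v : {x : Fin m → K // x ∈ Fintype.piFinset S} → K |
        ∀ c ∈ Submodule.span K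
          ((fun a : Fin m → ℕ => fun s : {x : Fin m → K // x ∈ Fintype.piFinset S} =>
              ∏ i, s.1 i ^ a i) ''
            ↑(Fintype.piFinset (fun i => Finset.range ((S i).card)) \
                Fintype.piFinset (fun i => Finset.Ico (k i) ((S i).card)))),
          ∑ s, v s * c s = 0}
      = ↑(Submodule.span K
          ((fun b : Fin m → ℕ => fun s : {x : Fin m → K // x ∈ Fintype.piFinset S} =>
              (∏ i, ∏ u ∈ (S i).erase (s.1 i), (s.1 i - u))⁻¹ * ∏ i, s.1 i ^ b i) ''
            ↑(Fintype.piFinset (fun i => Finset.range ((S i).card - k i))))) := by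
  have hmem (s : {x : Fin m → K // x ∈ Fintype.piFinset S}) (i : Fin m) : s.1 i ∈ S i :=
    Fintype.mem_piFinset.mp s.2 i
  ext v
  simp only [Set.mem_ofPred_eq, SetLike.mem_coe]
  constructor
  · intro hv
    let q (b : Fin m → ℕ) (t : {x : Fin m → K // x ∈ Fintype.piFinset S}) : K :=
      ∏ i, (∏ u ∈ (S i).erase (t.1 i), (Polynomial.X - Polynomial.C u)).coeff (b i)
    have hv_sum : v = ∑ b ∈ Fintype.piFinset (fun i => Finset.range ((S i).card)),
        (∑ t, v t * q b t) • fun s : {x : Fin m → K // x ∈ Fintype.piFinset S} =>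
          (∏ i, ∏ u ∈ (S i).erase (s.1 i), (s.1 i - u))⁻¹ * ∏ i, s.1 i ^ b i := by
      ext s
      have hne : (∏ i, ∏ u ∈ (S i).erase (s.1 i), (s.1 i - u)) ≠ 0 :=
        Finset.prod_ne_zero_iff.mpr fun i _ => Finset.prod_ne_zero_iff.mpr fun u hu =>
          sub_ne_zero.mpr (Finset.ne_of_mem_erase hu).symm
      have hkernel (t : {x : Fin m → K // x ∈ Fintype.piFinset S}) :
          ∑ b ∈ Fintype.piFinset (fun i => Finset.range ((S i).card)),
            q b t * ∏ i, s.1 i ^ b i = ∏ i, ∏ u ∈ (S i).erase (t.1 i), (s.1 i - u) := by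
        rw [Finset.prod_congr rfl fun i _ =>
          (sum_coeff_prod_erase_mul_pow (S i) (hmem t i) (s.1 i)).symm, Finset.prod_univ_sum]
        simp only [q, ← Finset.prod_mul_distrib]
      have hsum : ∑ t, v t * ∏ i, ∏ u ∈ (S i).erase (t.1 i), (s.1 i - u) =
          v s * ∏ i, ∏ u ∈ (S i).erase (s.1 i), (s.1 i - u) := by
        refine Finset.sum_eq_single s (fun t _ hts => ?_) (by simp)
        obtain ⟨i, hi⟩ := Function.ne_iff.mp fun h => hts (Subtype.ext h)
        rw [Finset.prod_eq_zero (Finset.mem_univ i), mul_zero]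
        exact Finset.prod_eq_zero (Finset.mem_erase.mpr ⟨Ne.symm hi, hmem s i⟩) (sub_self _)
      simp only [Finset.sum_apply, Pi.smul_apply, smul_eq_mul]
      calc v s = (∏ i, ∏ u ∈ (S i).erase (s.1 i), (s.1 i - u))⁻¹ *
            ∑ t, v t * ∏ i, ∏ u ∈ (S i).erase (t.1 i), (s.1 i - u) := by
            rw [hsum, mul_left_comm, inv_mul_cancel₀ hne, mul_one]
        _ = _ := by
            simp only [← hkernel, Finset.mul_sum, Finset.sum_mul]
            rw [Finset.sum_comm]
            refine Finset.sum_congr rfl fun b _ => Finset.sum_congr rfl fun t _ => ?_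
            ring
    rw [hv_sum]
    refine Submodule.sum_mem _ fun b hb => ?_
    by_cases hbk : b ∈ Fintype.piFinset (fun i => Finset.range ((S i).card - k i))
    · exact Submodule.smul_mem _ _ (Submodule.subset_span ⟨b, hbk, rfl⟩)
    · rw [hv (q b), zero_smul]
      · exact Submodule.zero_mem _
      simp only [Fintype.mem_piFinset, Finset.mem_range, not_forall, not_lt] at hb hbk
      obtain ⟨i, hi⟩ := hbk
      have hq : q b = ∑ a ∈ Fintype.piFinset (fun i => Finset.range ((S i).card - b i)),
          (∏ i, (∏ u ∈ S i, (Polynomial.X - Polynomial.C u)).coeff (a i + b i + 1)) •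
            fun s : {x : Fin m → K // x ∈ Fintype.piFinset S} => ∏ i, s.1 i ^ a i := by
        ext t
        simp only [q, Finset.sum_apply, Pi.smul_apply, smul_eq_mul, ← Finset.prod_mul_distrib]
        rw [Finset.prod_congr rfl fun i _ =>
          coeff_prod_erase_X_sub_C (S i) (hmem t i) (hb i).le, Finset.prod_univ_sum]
      rw [hq]
      refine Submodule.sum_mem _ fun a ha => Submodule.smul_mem _ _ (Submodule.subset_span
        ⟨a, ?_, rfl⟩)
      simp only [Fintype.mem_piFinset, Finset.mem_range] at ha
      have hai := ha i
      have hki := hk i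
      simp only [Finset.coe_sdiff, Set.mem_sdiff, Finset.mem_coe, Fintype.mem_piFinset,
        Finset.mem_range, Finset.mem_Ico]
      exact ⟨fun j => (ha j).trans_le (Nat.sub_le _ _), fun h => by have := h i; omega⟩
  · intro hv c hc
    induction hv, hc using Submodule.span_induction₂ with
    | mem_mem x y hx hy =>
      obtain ⟨b, hb, rfl⟩ := hx
      obtain ⟨a, ha, rfl⟩ := hy
      simp only [Finset.coe_sdiff, Set.mem_sdiff, Finset.mem_coe, Fintype.mem_piFinset,
        Finset.mem_range, Finset.mem_Ico, not_forall] at ha hb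
      obtain ⟨ha, i, hi⟩ := ha
      rw [Finset.sum_coe_sort (Fintype.piFinset S) (fun s =>
        ((∏ i, ∏ u ∈ (S i).erase (s i), (s i - u))⁻¹ * ∏ i, s i ^ b i) * ∏ i, s i ^ a i)]
      simp only [← Finset.prod_inv_distrib, ← Finset.prod_mul_distrib]
      rw [← Finset.prod_univ_sum S (fun i t =>
        (∏ u ∈ (S i).erase t, (t - u)⁻¹) * t ^ b i * t ^ a i)]
      refine Finset.prod_eq_zero (Finset.mem_univ i) ?_
      have hai := ha i
      have hbi := hb i
      simpa only [Finset.prod_inv_distrib, mul_assoc, ← pow_add] using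
        sum_inv_prod_erase_mul_pow_eq_zero (S i) (d := b i + a i) (by omega)
    | zero_left y hy => simp
    | zero_right x hx => simp
    | add_left x y z hx hy hz h₁ h₂ =>
      simp only [Pi.add_apply, add_mul, Finset.sum_add_distrib, h₁, h₂, add_zero]
    | add_right x y z hx hy hz h₁ h₂ =>
      simp only [Pi.add_apply, mul_add, Finset.sum_add_distrib, h₁, h₂, add_zero]
    | smul_left r x y hx hy h =>
      simp only [Pi.smul_apply, smul_eq_mul, mul_assoc, ← Finset.mul_sum, h, mul_zero]
    | smul_right r x y hx hy h =>
      simp only [Pi.smul_apply, smul_eq_mul, mul_left_comm, ← Finset.mul_sum, h, mul_zero]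
end

section
/- Let K be a field and S = S_1 × ⋯ × S_m ⊆ K^m a Cartesian product of finite subsets S_i ⊆ K with n_i = |S_i| ≥ 1, and let k_1,…,k_m be integers with 0 ≤ k_i ≤ n_i − 1. For j ∈ {1,…,m} let L_j = { a ∈ ℤ_{≥0}^m : k_j ≤ a_j ≤ n_j−1, a_i = n_i−1 for i ≠ j } and L'_j = { a ∈ ℤ_{≥0}^m : 0 ≤ a_j ≤ n_j−k_j−1, a_i = 0 for i ≠ j }, and set ACar2(S,k) = C(S, ∏_{i=1}^m {0,…,n_i−1} \ ⋃_{j=1}^m L_j). Then the orthogonal complement of ACar2(S,k) in K^S with respect to the standard bilinear form equals the K-span of the vectors (λ_s s^b)_{s∈S} for b ∈ ⋃_{j=1}^m L'_j. -/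
open Finset in
/-- A power sum weighted by the residues of `∏ (X - u)` vanishes below the critical degree. -/
theorem sum_inv_prod_sub_mul_pow_eq_zero {K : Type*} [Field K] [DecidableEq K]
    (S : Finset K) {t : ℕ} (ht : t + 1 < #S) :
    ∑ x ∈ S, (∏ u ∈ S.erase x, (x - u))⁻¹ * x ^ t = 0 := by
  have h := Lagrange.coeff_eq_sum (s := S) (v := id) (Function.injective_id.injOn)
    (P := (Polynomial.X ^ t : Polynomial K))
    (by rw [Polynomial.degree_X_pow]; exact_mod_cast (by omega : t < #S))
  rw [Polynomial.coeff_X_pow, if_neg (by omega)] at h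
  simpa [div_eq_inv_mul] using h.symm

/-- On a Cartesian product of finite sets, the monomials whose exponents are bounded by the sizes
of the factors have linearly independent evaluation vectors. -/
theorem linearIndepOn_eval_monomial_piFinset {K : Type*} [Field K] [DecidableEq K] {m : ℕ}
    (S : Fin m → Finset K) (hS : ∀ i, 1 ≤ (S i).card) :
    LinearIndepOn K
      (fun a : Fin m → ℕ => fun s : {x : Fin m → K // x ∈ Fintype.piFinset S} =>
        ∏ i, s.1 i ^ a i)
      (Fintype.piFinset (fun i => Finset.range ((S i).card)) : Set (Fin m → ℕ)) := by
  rw [linearIndepOn_finset_iff]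
  intro f hf
  set P : MvPolynomial (Fin m) K :=
    ∑ a ∈ Fintype.piFinset (fun i => Finset.range ((S i).card)),
      MvPolynomial.monomial (Finsupp.equivFunOnFinite.symm a) (f a) with hP
  have hcoeff (d : Fin m →₀ ℕ) : P.coeff d =
      if ⇑d ∈ Fintype.piFinset (fun i => Finset.range ((S i).card)) then f d else 0 := by
    rw [hP, MvPolynomial.coeff_sum]
    simp_rw [MvPolynomial.coeff_monomial, Equiv.symm_apply_eq]
    exact Finset.sum_ite_eq' _ _ _
  have hP0 : P = 0 := by
    refine MvPolynomial.eq_zero_of_eval_zero_at_prod_finset P S (fun i => ?_) (fun x hx => ?_)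
    · rw [MvPolynomial.degreeOf_lt_iff (hS i)]
      intro d hd
      rw [MvPolynomial.mem_support_iff, hcoeff, ite_ne_right_iff] at hd
      simpa using Fintype.mem_piFinset.1 hd.1 i
    · have := congrFun hf ⟨x, Fintype.mem_piFinset.2 hx⟩
      simpa [hP, MvPolynomial.eval_monomial, Finsupp.prod_fintype] using this
  intro a ha
  have := hcoeff (Finsupp.equivFunOnFinite.symm a)
  rw [hP0, MvPolynomial.coeff_zero] at this
  simpa [Fintype.mem_piFinset.1 ha, ha] using this.symm

/-- Two mutually orthogonal subspaces of complementary dimension are orthogonal complements for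
the dot product. -/
theorem setOf_dotProduct_eq_zero_eq_of_finrank {K ι : Type*} [Field K] [Fintype ι]
    (C D : Submodule K (ι → K)) (hCD : ∀ v ∈ D, ∀ c ∈ C, v ⬝ᵥ c = 0)
    (hrank : Module.finrank K C + Module.finrank K D = Fintype.card ι) :
    {v : ι → K | ∀ c ∈ C, v ⬝ᵥ c = 0} = D := by
  classical
  let B : LinearMap.BilinForm K (ι → K) := dotProductBilin K K
  have hB : B.Nondegenerate :=
    ⟨fun v hv => dotProduct_eq_zero v hv,
      fun v hv => dotProduct_eq_zero v fun w => (dotProduct_comm v w).trans (hv w)⟩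
  have hset : {v : ι → K | ∀ c ∈ C, v ⬝ᵥ c = 0} = B.orthogonal C := by
    ext v
    simp only [Set.mem_ofPred_eq, SetLike.mem_coe, LinearMap.BilinForm.mem_orthogonal_iff]
    exact forall₂_congr fun c _ => by rw [dotProduct_comm]; rfl
  have hle : D ≤ B.orthogonal C := fun v hv => by
    rw [← SetLike.mem_coe, ← hset]
    exact hCD v hv
  rw [hset, Submodule.eq_of_le_of_finrank_eq hle]
  rw [LinearMap.BilinForm.finrank_orthogonal hB, Module.finrank_fintype_fun_eq_card]
  omega

/-- A family that is linearly independent on a finite set spans a subspace of that dimension. -/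
theorem LinearIndepOn.finrank_span_image_finset {K V ι : Type*} [Field K] [AddCommGroup V]
    [Module K V] {v : ι → V} {s : Finset ι} (h : LinearIndepOn K v (s : Set ι)) :
    Module.finrank K (Submodule.span K (v '' (s : Set ι))) = s.card := by
  rw [Set.image_eq_range]
  exact (finrank_span_eq_card (b := fun i : (s : Set ι) => v i) h).trans (by simp)

/-- The cross of exponents through the top corner of the box and its reflection, the cross through
the origin, have the same size. -/
theorem card_biUnion_piFinset_reflect {m : ℕ} (n k : Fin m → ℕ) (hk : ∀ i, k i + 1 ≤ n i) :
    (Finset.univ.biUnion (fun j : Fin m => Fintype.piFinset (fun i =>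
        if i = j then Finset.Icc (k j) (n j - 1) else {n i - 1}))).card =
      (Finset.univ.biUnion (fun j : Fin m => Fintype.piFinset (fun i =>
        if i = j then Finset.range (n j - k j) else {0}))).card := by
  refine Finset.card_nbij' (fun a i => n i - 1 - a i) (fun a i => n i - 1 - a i) ?_ ?_ ?_ ?_
  all_goals
    intro a ha
    simp only [Finset.coe_biUnion, Set.mem_iUnion, Finset.mem_coe, Fintype.mem_piFinset] at ha ⊢
    obtain ⟨j, -, hj⟩ := ha
  · refine ⟨j, Finset.mem_univ j, fun i => ?_⟩
    have h1 := hj i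
    have h2 := hk i
    split_ifs at * with hij
    · subst hij
      simp only [Finset.mem_range, Finset.mem_Icc] at *
      omega
    · simp only [Finset.mem_singleton] at *
      omega
  · refine ⟨j, Finset.mem_univ j, fun i => ?_⟩
    have h1 := hj i
    have h2 := hk i
    split_ifs at * with hij
    · subst hij
      simp only [Finset.mem_range, Finset.mem_Icc] at *
      omega
    · simp only [Finset.mem_singleton] at *
      omega
  all_goals
    funext i
    have h1 := hj i
    have h2 := hk i
    split_ifs at h1 with hij
    · subst hij
      simp only [Finset.mem_range, Finset.mem_Icc] at h1
      omega
    · simp only [Finset.mem_singleton] at h1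
      omega

/-- The dual of the augmented Cartesian code 2,
`ACar2(S,k) = C(S, ∏_i {0,…,n_i−1} \ ⋃_j L_j)` with
`L_j = { a : k_j ≤ a_j ≤ n_j−1, a_i = n_i−1 for i ≠ j }` and `0 ≤ k_i ≤ n_i − 1`,
equals the span of the residue vectors `(λ_s s^b)_{s ∈ S}` for
`b ∈ ⋃_j L'_j`, where `L'_j = { a : 0 ≤ a_j ≤ n_j−k_j−1, a_i = 0 for i ≠ j }`. -/
theorem dual_ACar2 {K : Type*} [Field K] [DecidableEq K] {m : ℕ}
    (S : Fin m → Finset K) (hS : ∀ i, 1 ≤ (S i).card)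
    (k : Fin m → ℕ) (hk : ∀ i, k i + 1 ≤ (S i).card) :
    {v : {x : Fin m → K // x ∈ Fintype.piFinset S} → K |
        ∀ c ∈ Submodule.span K
          ((fun a : Fin m → ℕ => fun s : {x : Fin m → K // x ∈ Fintype.piFinset S} =>
              ∏ i, s.1 i ^ a i) ''
            ↑(Fintype.piFinset (fun i => Finset.range ((S i).card)) \
                Finset.univ.biUnion (fun j : Fin m =>
                  Fintype.piFinset (fun i =>
                    if i = j then Finset.Icc (k j) ((S j).card - 1)
                    else {(S i).card - 1})))),
          ∑ s, v s * c s = 0}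
      = ↑(Submodule.span K
          ((fun b : Fin m → ℕ => fun s : {x : Fin m → K // x ∈ Fintype.piFinset S} =>
              (∏ i, ∏ u ∈ (S i).erase (s.1 i), (s.1 i - u))⁻¹ * ∏ i, s.1 i ^ b i) ''
            ↑(Finset.univ.biUnion (fun j : Fin m =>
                Fintype.piFinset (fun i =>
                  if i = j then Finset.range ((S j).card - k j) else {0}))))) := by
  have hlam (s : {x : Fin m → K // x ∈ Fintype.piFinset S}) :
      (∏ i, ∏ u ∈ (S i).erase (s.1 i), (s.1 i - u))⁻¹ ≠ 0 := by
    refine inv_ne_zero (Finset.prod_ne_zero_iff.2 fun i _ => Finset.prod_ne_zero_iff.2 ?_)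
    exact fun u hu => sub_ne_zero.2 (Finset.ne_of_mem_erase hu).symm
  have hindep := linearIndepOn_eval_monomial_piFinset S hS
  refine setOf_dotProduct_eq_zero_eq_of_finrank _ _ (fun v hv c hc => ?_) ?_
  · induction hv, hc using Submodule.span_induction₂ with
    | mem_mem v c hv hc =>
      obtain ⟨b, hb, rfl⟩ := hv
      obtain ⟨a, ha, rfl⟩ := hc
      simp only [Finset.coe_sdiff, Set.mem_sdiff, Finset.mem_coe, Finset.mem_biUnion,
        Finset.mem_univ, true_and, Fintype.mem_piFinset, Finset.mem_range] at ha hb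
      obtain ⟨j, hj⟩ := hb
      obtain ⟨i, hi⟩ : ∃ i, b i + a i + 1 < (S i).card := by
        by_contra! hcon
        refine ha.2 ⟨j, fun i => ?_⟩
        have h1 := hj i
        have h2 := hcon i
        have h3 := ha.1 i
        have h4 := hk i
        split_ifs at * with hij
        · subst hij
          simp only [Finset.mem_range, Finset.mem_Icc] at *
          omega
        · simp only [Finset.mem_singleton] at *
          omega
      calc _ = ∑ s : {x : Fin m → K // x ∈ Fintype.piFinset S},
            ∏ i, (∏ u ∈ (S i).erase (s.1 i), (s.1 i - u))⁻¹ * s.1 i ^ (b i + a i) := by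
            refine Finset.sum_congr rfl fun s _ => ?_
            simp only [pow_add, Finset.prod_mul_distrib, Finset.prod_inv_distrib, mul_assoc]
        _ = ∑ x ∈ Fintype.piFinset S,
            ∏ i, (∏ u ∈ (S i).erase (x i), (x i - u))⁻¹ * x i ^ (b i + a i) :=
          Finset.sum_coe_sort (Fintype.piFinset S) fun x =>
            ∏ i, (∏ u ∈ (S i).erase (x i), (x i - u))⁻¹ * x i ^ (b i + a i)
        _ = ∏ i, ∑ x ∈ S i, (∏ u ∈ (S i).erase x, (x - u))⁻¹ * x ^ (b i + a i) :=
          (Finset.prod_univ_sum S fun i x =>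
            (∏ u ∈ (S i).erase x, (x - u))⁻¹ * x ^ (b i + a i)).symm
        _ = 0 := Finset.prod_eq_zero (Finset.mem_univ i) (sum_inv_prod_sub_mul_pow_eq_zero _ hi)
    | zero_left => exact zero_dotProduct _
    | zero_right => exact dotProduct_zero _
    | add_left _ _ _ _ _ _ h1 h2 => rw [add_dotProduct, h1, h2, add_zero]
    | add_right _ _ _ _ _ _ h1 h2 => rw [dotProduct_add, h1, h2, add_zero]
    | smul_left _ _ _ _ _ h => rw [smul_dotProduct, h, smul_zero]
    | smul_right _ _ _ _ _ h => rw [dotProduct_smul, h, smul_zero]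
  · have hL : Finset.univ.biUnion (fun j : Fin m => Fintype.piFinset (fun i =>
          if i = j then Finset.Icc (k j) ((S j).card - 1) else {(S i).card - 1})) ⊆
        Fintype.piFinset (fun i => Finset.range ((S i).card)) := by
      refine Finset.biUnion_subset.2 fun j _ => Fintype.piFinset_subset _ _ fun i => ?_
      intro x hx
      have := hS i
      split_ifs at hx with hij
      · subst hij
        simp only [Finset.mem_range, Finset.mem_Icc] at *
        omega
      · simp only [Finset.mem_range, Finset.mem_singleton] at *
        omega
    have hL' : Finset.univ.biUnion (fun j : Fin m => Fintype.piFinset (fun i =>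
          if i = j then Finset.range ((S j).card - k j) else {0})) ⊆
        Fintype.piFinset (fun i => Finset.range ((S i).card)) := by
      refine Finset.biUnion_subset.2 fun j _ => Fintype.piFinset_subset _ _ fun i => ?_
      intro x hx
      have := hS i
      split_ifs at hx with hij
      · subst hij
        simp only [Finset.mem_range] at *
        omega
      · simp only [Finset.mem_range, Finset.mem_singleton] at *
        omega
    have htwist := (hindep.mono (Finset.coe_subset.2 hL')).map_injOn
      (LinearMap.mulLeft K fun s : {x : Fin m → K // x ∈ Fintype.piFinset S} =>
        (∏ i, ∏ u ∈ (S i).erase (s.1 i), (s.1 i - u))⁻¹)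
      (fun v _ w _ hvw => funext fun s => mul_left_cancel₀ (hlam s) (congrFun hvw s))
    rw [(hindep.mono (Finset.coe_subset.2 Finset.sdiff_subset)).finrank_span_image_finset,
      Finset.card_sdiff_of_subset hL, card_biUnion_piFinset_reflect _ k hk]
    have hrank := htwist.finrank_span_image_finset
    refine (congrArg (_ + ·) hrank).trans ?_
    have hcard := Finset.card_le_card hL'
    rw [Nat.sub_add_cancel hcard, Fintype.card_coe, Fintype.card_piFinset, Fintype.card_piFinset]
    simp
end

section
/- Let q be a prime power, t ≥ 1, K = F_{q^t} with trace Tr = Tr_{K/F_q}, m ≥ 1, and S = S_1 × ⋯ × S_m ⊆ K^m a Cartesian product of finite subsets with n_i = |S_i| and q^{t−1} ≤ n_j for a fixed index j. Let L_j = { a ∈ ℤ_{≥0}^m : n_j − q^{t−1} ≤ a_j ≤ n_j−1, a_i = n_i−1 for i ≠ j } and let A ⊆ ∏_{i=1}^m {0,…,n_i−1} satisfy A ∩ L_j = ∅. Fix s* ∈ S, let Γ = { s ∈ S : s_j = s*_j }, and let f be in the K-span of the monomials x^a, a ∈ A. Then for every z ∈ K: Tr(z λ_{s*} f(s*)) =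 − ∑_{s ∈ Γ \ {s*}} Tr(λ_s z f(s)) − ∑_{s ∈ S \ Γ} Tr(z(s_j − s*_j)) · Tr(λ_s f(s)/(s_j − s*_j)). In particular, the erased symbol f(s*) is determined by the q-ary subsymbols Tr(λ_s z_i f(s)), i = 1,…,t, for s ∈ Γ \ {s*} and Tr(λ_s f(s)/(s_j − s*_j)) for s ∈ S \ Γ, where {z_1,…,z_t} is any F_q-basis of K. -/
/-- The field trace `Tr_{K/F_q}(x) = x^{q^{t−1}} + ⋯ + x^q + x` of `K = F_{q^t}`. -/
def fieldTr {K : Type*} [Field K] (q t : ℕ) (x : K) : K :=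
  ∑ l ∈ Finset.range t, x ^ q ^ l

/-- The Lagrange coefficient `λ_s = (∏_i ∏_{u ∈ S_i \ {s_i}} (s_i − u))⁻¹` at a point `s`
of the Cartesian product `S_1 × ⋯ × S_m`. -/
noncomputable def lagrangeCoeff {K : Type*} [Field K] [DecidableEq K] {m : ℕ}
    (S : Fin m → Finset K) (s : Fin m → K) : K :=
  (∏ i, ∏ u ∈ (S i).erase (s i), (s i - u))⁻¹

section FieldTrace

variable {K : Type*} [Field K] {q : ℕ}

theorem sum_pow_pow_of_charP_prime_pow {p e : ℕ} [Fact p.Prime] [CharP K p] (hq : q = p ^ e)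
    {ι : Type*} (s : Finset ι) (g : ι → K) (l : ℕ) :
    (∑ i ∈ s, g i) ^ q ^ l = ∑ i ∈ s, g i ^ q ^ l := by
  rw [hq, ← pow_mul]
  exact sum_pow_char_pow p _ s g

theorem fieldTr_sum {p e : ℕ} [Fact p.Prime] [CharP K p] (hq : q = p ^ e) (t : ℕ)
    {ι : Type*} (s : Finset ι) (g : ι → K) :
    fieldTr q t (∑ i ∈ s, g i) = ∑ i ∈ s, fieldTr q t (g i) := by
  simp only [fieldTr, sum_pow_pow_of_charP_prime_pow hq]
  exact Finset.sum_comm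

theorem fieldTr_zero (hq : q ≠ 0) (t : ℕ) : fieldTr q t (0 : K) = 0 :=
  Finset.sum_eq_zero fun l _ => zero_pow (pow_ne_zero l hq)

theorem fieldTr_pow {p e : ℕ} [Fact p.Prime] [CharP K p] (hq : q = p ^ e) [Fintype K] {t : ℕ}
    (hK : Fintype.card K = q ^ t) (x : K) : fieldTr q t x ^ q = fieldTr q t x := by
  have h := sum_pow_pow_of_charP_prime_pow hq (Finset.range t) (fun l => x ^ q ^ l) 1
  have hx : x ^ q ^ t = x := by rw [← hK, FiniteField.pow_card]
  have h₁ := Finset.sum_range_succ (fun l => x ^ q ^ l) t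
  have h₂ := Finset.sum_range_succ' (fun l => x ^ q ^ l) t
  simp only [pow_one, ← pow_mul, ← pow_succ] at h
  rw [fieldTr, h]
  rw [h₁, hx, pow_zero, pow_one] at h₂
  exact (add_right_cancel h₂).symm

theorem fieldTr_mul_of_pow_eq {c : K} (hc : c ^ q = c) (t : ℕ) (x : K) :
    fieldTr q t (c * x) = c * fieldTr q t x := by
  have h (l : ℕ) : c ^ q ^ l = c := by
    induction l with
    | zero => simp
    | succ l ih => rw [pow_succ, pow_mul, ih, hc]
  simp only [fieldTr, mul_pow, h, Finset.mul_sum]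

open Polynomial in
/-- The polynomial `Tr(z (X - c)) / (X - c)`. -/
noncomputable def traceQuotient (q t : ℕ) (z c : K) : K[X] :=
  ∑ l ∈ Finset.range t, C (z ^ q ^ l) * (X - C c) ^ (q ^ l - 1)

theorem natDegree_traceQuotient_le (hq : 0 < q) (t : ℕ) (z c : K) :
    (traceQuotient q t z c).natDegree ≤ q ^ (t - 1) - 1 := by
  refine Polynomial.natDegree_sum_le_of_forall_le _ _ fun l hl => ?_
  refine (Polynomial.natDegree_C_mul_le _ _).trans ?_
  rw [Polynomial.natDegree_pow, Polynomial.natDegree_X_sub_C, mul_one]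
  have hl := Finset.mem_range.mp hl
  exact Nat.sub_le_sub_right (Nat.pow_le_pow_right hq (by lia)) 1

theorem eval_traceQuotient (q t : ℕ) (z c x : K) :
    (traceQuotient q t z c).eval x =
      ∑ l ∈ Finset.range t, z ^ q ^ l * (x - c) ^ (q ^ l - 1) := by
  simp [traceQuotient, Polynomial.eval_finsetSum]

theorem eval_traceQuotient_self (hq : 1 < q) {t : ℕ} (ht : 1 ≤ t) (z c : K) :
    (traceQuotient q t z c).eval c = z := by
  rw [eval_traceQuotient, Finset.sum_eq_single_of_mem 0 (Finset.mem_range.mpr ht)]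
  · simp
  · intro l _ hl
    have := Nat.one_lt_pow hl hq
    rw [sub_self, zero_pow (by lia), mul_zero]

theorem eval_traceQuotient_of_ne (hq : 0 < q) (t : ℕ) (z : K) {c x : K} (hx : x ≠ c) :
    (traceQuotient q t z c).eval x = fieldTr q t (z * (x - c)) / (x - c) := by
  have hxc := sub_ne_zero.mpr hx
  rw [eq_div_iff hxc, eval_traceQuotient, Finset.sum_mul, fieldTr]
  refine Finset.sum_congr rfl fun l _ => ?_
  rw [mul_assoc, pow_sub_one_mul (pow_pos hq l).ne', mul_pow]

end FieldTrace

section Orthogonality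

variable {K : Type*} [Field K] [DecidableEq K]

theorem sum_eval_div_prod_sub_eq_zero (s : Finset K) {P : Polynomial K}
    (hP : P.natDegree + 1 < s.card) :
    ∑ u ∈ s, P.eval u / ∏ v ∈ s.erase u, (u - v) = 0 := by
  have h := Lagrange.coeff_eq_sum (s := s) (v := id) Function.injective_id.injOn (P := P)
    (Polynomial.degree_le_natDegree.trans_lt (by exact_mod_cast (by lia : P.natDegree < s.card)))
  rw [Polynomial.coeff_eq_zero_of_natDegree_lt (by lia)] at h
  exact h.symm

theorem sum_lagrangeCoeff_mul_prod_eval_eq_zero {m : ℕ} (S : Fin m → Finset K)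
    (P : Fin m → Polynomial K) {i : Fin m} (hi : (P i).natDegree + 1 < (S i).card) :
    ∑ s ∈ Fintype.piFinset S, lagrangeCoeff S s * ∏ k, (P k).eval (s k) = 0 := by
  have h := Finset.prod_univ_sum S
    fun k u => (P k).eval u / ∏ v ∈ (S k).erase u, (u - v)
  rw [Finset.prod_eq_zero (Finset.mem_univ i) (sum_eval_div_prod_sub_eq_zero _ hi)] at h
  rw [h]
  refine Finset.sum_congr rfl fun s _ => ?_
  rw [lagrangeCoeff, Finset.prod_div_distrib, div_eq_mul_inv, mul_comm]

theorem sum_lagrangeCoeff_mul_eval_mul_eq_zero {m : ℕ} (S : Fin m → Finset K) (j : Fin m)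
    {d : ℕ} {G : Polynomial K} (hG : G.natDegree ≤ d) {A : Set (Fin m → ℕ)}
    (hA : ∀ a ∈ A, a j + d + 1 < (S j).card ∨ ∃ i, i ≠ j ∧ a i + 1 < (S i).card)
    {f : (Fin m → K) → K}
    (hf : f ∈ Submodule.span K
        ((fun a : Fin m → ℕ => fun x : Fin m → K => ∏ i, x i ^ a i) '' A)) :
    ∑ s ∈ Fintype.piFinset S, lagrangeCoeff S s * (G.eval (s j) * f s) = 0 := by
  induction hf using Submodule.span_induction with
  | zero => simp
  | add f g _ _ hf hg => simp [mul_add, Finset.sum_add_distrib, hf, hg]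
  | smul c f _ hf =>
    rw [← mul_zero c, ← hf, Finset.mul_sum]
    refine Finset.sum_congr rfl fun s _ => ?_
    rw [Pi.smul_apply, smul_eq_mul]
    ring
  | mem f hf =>
    obtain ⟨a, ha, rfl⟩ := hf
    let P : Fin m → Polynomial K := fun k => (if k = j then G else 1) * Polynomial.X ^ a k
    have hP (s : Fin m → K) :
        ∏ k, (P k).eval (s k) = G.eval (s j) * ∏ k, s k ^ a k := by
      simp only [P, Polynomial.eval_mul, Finset.prod_mul_distrib, Polynomial.eval_pow,
        Polynomial.eval_X, apply_ite (Polynomial.eval _), Polynomial.eval_one,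
        Finset.prod_ite_eq', Finset.mem_univ, if_true]
    simp only [← hP]
    obtain h | ⟨i, hij, hi⟩ := hA a ha
    · refine sum_lagrangeCoeff_mul_prod_eval_eq_zero S P (i := j) ?_
      have h₁ := Polynomial.natDegree_mul_le (p := G) (q := Polynomial.X ^ a j)
      simp only [Polynomial.natDegree_X_pow] at h₁
      simp only [P, if_true]
      lia
    · refine sum_lagrangeCoeff_mul_prod_eval_eq_zero S P (i := i) ?_
      simpa [P, hij] using hi

end Orthogonality

/-- Single-erasure repair identity for a decreasing monomial-Cartesian code whose exponent set
`A` avoids `L_j`: for `s* ∈ S`, `Γ = { s ∈ S : s_j = s*_j }`, any `f` in the span of the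
monomial functions `x^a`, `a ∈ A`, and every `z ∈ K`,
`Tr(z λ_{s*} f(s*)) = − ∑_{s ∈ Γ∖{s*}} Tr(λ_s z f(s))
  − ∑_{s ∈ S∖Γ} Tr(z(s_j − s*_j)) · Tr(λ_s f(s)/(s_j − s*_j))`,
so the erased symbol `f(s*)` is determined by the subsymbols
`Tr(λ_s z_i f(s))` (`s ∈ Γ∖{s*}`) and `Tr(λ_s f(s)/(s_j − s*_j))` (`s ∈ S∖Γ`). -/
theorem single_erasure_repair {K : Type*} [Field K] [Fintype K] [DecidableEq K]
    {q t m : ℕ} (hq : IsPrimePow q) (ht : 1 ≤ t) (hK : Fintype.card K = q ^ t)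
    (S : Fin m → Finset K) (hS : ∀ i, 1 ≤ (S i).card)
    (j : Fin m) (hj : q ^ (t - 1) ≤ (S j).card)
    (A : Set (Fin m → ℕ)) (hbox : ∀ a ∈ A, ∀ i, a i < (S i).card)
    (hAL : ∀ a ∈ A, ¬((S j).card - q ^ (t - 1) ≤ a j ∧ a j ≤ (S j).card - 1 ∧
        ∀ i, i ≠ j → a i = (S i).card - 1))
    (sstar : Fin m → K) (hsstar : sstar ∈ Fintype.piFinset S)
    (f : (Fin m → K) → K)
    (hf : f ∈ Submodule.span K
        ((fun a : Fin m → ℕ => fun x : Fin m → K => ∏ i, x i ^ a i) '' A))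
    (z : K) :
    fieldTr q t (z * lagrangeCoeff S sstar * f sstar)
      = - (∑ s ∈ ((Fintype.piFinset S).filter (fun s => s j = sstar j)).erase sstar,
            fieldTr q t (lagrangeCoeff S s * z * f s))
        - ∑ s ∈ Fintype.piFinset S \ (Fintype.piFinset S).filter (fun s => s j = sstar j),
            fieldTr q t (z * (s j - sstar j)) *
              fieldTr q t (lagrangeCoeff S s * f s / (s j - sstar j)) := by
  obtain ⟨p, e, hp, he, rfl⟩ := (isPrimePow_nat_iff q).mp hq
  have : Fact p.Prime := ⟨hp⟩
  have : CharP K p := charP_of_card_eq_prime_pow (hK.trans (pow_mul p e t).symm)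
  generalize hqp : p ^ e = q at *
  have hq₁ : 1 < q := hq.one_lt
  have hq₀ : 0 < q := hq.pos
  have hqt : 0 < q ^ (t - 1) := pow_pos hq₀ _
  have horth := sum_lagrangeCoeff_mul_eval_mul_eq_zero S j
    (natDegree_traceQuotient_le hq₀ t z (sstar j)) (A := A) (fun a ha => by
      by_contra! hcon
      refine hAL a ha ⟨by lia, Nat.le_sub_one_of_lt (hbox a ha j), fun i hi => ?_⟩
      have h₁ := hcon.2 i hi
      have h₂ := hbox a ha i
      lia) hf
  have hmem : sstar ∈ (Fintype.piFinset S).filter (fun s => s j = sstar j) :=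
    Finset.mem_filter.mpr ⟨hsstar, rfl⟩
  have htr := fieldTr_sum hqp.symm t (Fintype.piFinset S) fun s =>
    lagrangeCoeff S s * ((traceQuotient q t z (sstar j)).eval (s j) * f s)
  rw [horth, fieldTr_zero hq₀.ne',
    ← Finset.sum_sdiff (Finset.filter_subset (fun s => s j = sstar j) (Fintype.piFinset S)),
    ← Finset.add_sum_erase _ _ hmem,
    eval_traceQuotient_self hq₁ ht] at htr
  have hΓ : ∑ s ∈ ((Fintype.piFinset S).filter (fun s => s j = sstar j)).erase sstar,
        fieldTr q t (lagrangeCoeff S s *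
          ((traceQuotient q t z (sstar j)).eval (s j) * f s)) =
      ∑ s ∈ ((Fintype.piFinset S).filter (fun s => s j = sstar j)).erase sstar,
        fieldTr q t (lagrangeCoeff S s * z * f s) := by
    refine Finset.sum_congr rfl fun s hs => ?_
    rw [(Finset.mem_filter.mp (Finset.mem_of_mem_erase hs)).2,
      eval_traceQuotient_self hq₁ ht, mul_assoc]
  have hcompl : ∑ s ∈ Fintype.piFinset S \
          (Fintype.piFinset S).filter (fun s => s j = sstar j),
        fieldTr q t (lagrangeCoeff S s *
          ((traceQuotient q t z (sstar j)).eval (s j) * f s)) =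
      ∑ s ∈ Fintype.piFinset S \ (Fintype.piFinset S).filter (fun s => s j = sstar j),
        fieldTr q t (z * (s j - sstar j)) *
          fieldTr q t (lagrangeCoeff S s * f s / (s j - sstar j)) := by
    refine Finset.sum_congr rfl fun s hs => ?_
    have hsj : s j ≠ sstar j := fun h =>
      (Finset.mem_sdiff.mp hs).2 (Finset.mem_filter.mpr ⟨(Finset.mem_sdiff.mp hs).1, h⟩)
    rw [eval_traceQuotient_of_ne hq₀ t z hsj,
      ← fieldTr_mul_of_pow_eq (fieldTr_pow hqp.symm hK _)]
    congr 1
    ring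
  rw [hΓ, hcompl] at htr
  rw [mul_comm z (lagrangeCoeff S sstar), mul_assoc]
  linear_combination -htr
end

section
/- Let q be a prime power, t ≥ 1, K = F_{q^t} with trace Tr = Tr_{K/F_q}, m ≥ 1, and S = S_1 × ⋯ × S_m ⊆ K^m a Cartesian product of finite subsets with n_i = |S_i| and q^{t−1} ≤ n_j for a fixed index j. Let L_j = { a ∈ ℤ_{≥0}^m : n_j − q^{t−1} ≤ a_j ≤ n_j−1, a_i = n_i−1 for i ≠ j } and let A ⊆ ∏_{i=1}^m {0,…,n_i−1} satisfy A ∩ L_j = ∅. Let s*, s' ∈ S with s*_j ≠ s'_j, let τ ∈ K, and let z ∈ K satisfy Tr(z(s'_j − s*_j)) = 0. Define p: S → K by p(s) = τ z if s_j = s*_j and p(s) = τ · Tr(z(s_j − s*_j))/(s_j − s*_j) if s_j ≠ s*_j. Then for every f in the K-span of the monomials x^a, a ∈ A: λ_{s*} τ z f(s*) = − ∑_{s ∈ S \ {s*, s'}} λ_s p(s) f(s); in particular, the left-hand side involves only the erased symbol f(s*) and not f(s'). -/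
open Polynomial in
theorem sum_inv_prod_sub_mul_eval_eq_zero {K : Type*} [Field K] [DecidableEq K]
    (T : Finset K) (P : K[X]) (hP : P.natDegree + 1 < T.card) :
    ∑ u ∈ T, (∏ v ∈ T.erase u, (u - v))⁻¹ * P.eval u = 0 := by
  have hdeg : P.degree < T.card :=
    P.degree_le_natDegree.trans_lt (by exact_mod_cast (Nat.lt_succ_self _).trans hP)
  have h := Lagrange.coeff_eq_sum (s := T) (v := id) (Set.injOn_id _) hdeg
  rw [coeff_eq_zero_of_natDegree_lt (by omega)] at h
  rw [h]
  exact Finset.sum_congr rfl fun u _ => by simp [div_eq_mul_inv, mul_comm]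

theorem sum_lagrangeCoeff_mul_prod {K : Type*} [Field K] [DecidableEq K] {m : ℕ}
    (S : Fin m → Finset K) (g : Fin m → K → K) :
    ∑ s ∈ Fintype.piFinset S, lagrangeCoeff S s * ∏ i, g i (s i)
      = ∏ i, ∑ u ∈ S i, (∏ v ∈ (S i).erase u, (u - v))⁻¹ * g i u := by
  rw [Finset.prod_univ_sum]
  refine Finset.sum_congr rfl fun s _ => ?_
  rw [lagrangeCoeff, Finset.prod_mul_distrib, Finset.prod_inv_distrib]

open Polynomial in
theorem sum_lagrangeCoeff_mul_eval_mul_prod_pow_eq_zero {K : Type*} [Field K] [DecidableEq K]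
    {m : ℕ} (S : Fin m → Finset K) (j : Fin m) (P : K[X]) (a : Fin m → ℕ)
    (ha : (∃ i, i ≠ j ∧ a i + 1 < (S i).card) ∨ P.natDegree + a j + 1 < (S j).card) :
    ∑ s ∈ Fintype.piFinset S, lagrangeCoeff S s * (P.eval (s j) * ∏ i, s i ^ a i) = 0 := by
  have h := sum_lagrangeCoeff_mul_prod S
    (fun i u => ((if i = j then P else 1) * X ^ a i).eval u)
  have hprod (s : Fin m → K) : ∏ i, ((if i = j then P else 1) * X ^ a i).eval (s i)
      = P.eval (s j) * ∏ i, s i ^ a i := by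
    simp only [eval_mul, eval_pow, eval_X, Finset.prod_mul_distrib]
    congr 1
    rw [Finset.prod_eq_single j] <;> simp +contextual
  simp only [hprod] at h
  rw [h]
  obtain ⟨i, hij, hi⟩ | hj := ha
  · refine Finset.prod_eq_zero (Finset.mem_univ i) (sum_inv_prod_sub_mul_eval_eq_zero _ _ ?_)
    simpa [hij] using hi
  · refine Finset.prod_eq_zero (Finset.mem_univ j) (sum_inv_prod_sub_mul_eval_eq_zero _ _ ?_)
    have := natDegree_mul_le (p := P) (q := X ^ a j)
    rw [natDegree_X_pow] at this
    simp only [if_true]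
    omega

open Polynomial in
/-- The polynomial `Tr(z(X − c)) / (X − c)`. -/
noncomputable def fieldTrQuotient {K : Type*} [Field K] (q t : ℕ) (z c : K) : K[X] :=
  ∑ l ∈ Finset.range t, C (z ^ q ^ l) * (X - C c) ^ (q ^ l - 1)

theorem natDegree_fieldTrQuotient_le {K : Type*} [Field K] {q t : ℕ} (hq : 1 ≤ q) (z c : K) :
    (fieldTrQuotient q t z c).natDegree ≤ q ^ (t - 1) - 1 := by
  refine Polynomial.natDegree_sum_le_of_forall_le _ _ fun l hl => ?_
  refine (Polynomial.natDegree_C_mul_le _ _).trans ?_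
  rw [Polynomial.natDegree_pow, Polynomial.natDegree_X_sub_C, mul_one]
  have := Finset.mem_range.mp hl
  exact Nat.sub_le_sub_right (Nat.pow_le_pow_right hq (by omega)) 1

theorem eval_fieldTrQuotient_self {K : Type*} [Field K] {q t : ℕ} (hq : 2 ≤ q) (ht : 1 ≤ t)
    (z c : K) : (fieldTrQuotient q t z c).eval c = z := by
  rw [fieldTrQuotient, Polynomial.eval_finsetSum,
    Finset.sum_eq_single_of_mem 0 (Finset.mem_range.mpr ht)]
  · simp
  · intro l _ hl
    have : q ^ l - 1 ≠ 0 := by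
      have := Nat.one_lt_pow hl hq
      omega
    simp [this]

theorem eval_fieldTrQuotient_of_ne {K : Type*} [Field K] {q t : ℕ} (hq : 1 ≤ q)
    (z : K) {c y : K} (h : y ≠ c) :
    (fieldTrQuotient q t z c).eval y = fieldTr q t (z * (y - c)) / (y - c) := by
  rw [eq_div_iff (sub_ne_zero.mpr h), fieldTrQuotient, Polynomial.eval_finsetSum,
    Finset.sum_mul, fieldTr]
  refine Finset.sum_congr rfl fun l _ => ?_
  have := Nat.one_le_pow l q hq
  simp [mul_assoc, mul_pow, ← pow_succ, Nat.sub_add_cancel this]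

/-- Two-erasure repair identity for a decreasing monomial-Cartesian code whose exponent set `A`
avoids `L_j`: for `s*, s' ∈ S` with `s*_j ≠ s'_j`, any `τ ∈ K`, any `z ∈ K` with
`Tr(z(s'_j − s*_j)) = 0`, and the repair function
`p(s) = τz` if `s_j = s*_j`, `p(s) = τ·Tr(z(s_j − s*_j))/(s_j − s*_j)` otherwise, one has,
for every `f` in the span of the monomial functions `x^a`, `a ∈ A`,
`λ_{s*} τ z f(s*) = − ∑_{s ∈ S∖{s*,s'}} λ_s p(s) f(s)`;
the left-hand side involves only the erased symbol `f(s*)` and not `f(s')`. -/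
theorem two_erasure_repair {K : Type*} [Field K] [Fintype K] [DecidableEq K]
    {q t m : ℕ} (hq : IsPrimePow q) (ht : 1 ≤ t) (hK : Fintype.card K = q ^ t)
    (S : Fin m → Finset K) (hS : ∀ i, 1 ≤ (S i).card)
    (j : Fin m) (hj : q ^ (t - 1) ≤ (S j).card)
    (A : Set (Fin m → ℕ)) (hbox : ∀ a ∈ A, ∀ i, a i < (S i).card)
    (hAL : ∀ a ∈ A, ¬((S j).card - q ^ (t - 1) ≤ a j ∧ a j ≤ (S j).card - 1 ∧
        ∀ i, i ≠ j → a i = (S i).card - 1))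
    (sstar sprime : Fin m → K)
    (hsstar : sstar ∈ Fintype.piFinset S) (hsprime : sprime ∈ Fintype.piFinset S)
    (hjne : sstar j ≠ sprime j)
    (τ z : K) (hz : fieldTr q t (z * (sprime j - sstar j)) = 0)
    (f : (Fin m → K) → K)
    (hf : f ∈ Submodule.span K
        ((fun a : Fin m → ℕ => fun x : Fin m → K => ∏ i, x i ^ a i) '' A)) :
    lagrangeCoeff S sstar * (τ * z) * f sstar
      = - ∑ s ∈ Fintype.piFinset S \ {sstar, sprime},
          lagrangeCoeff S s *
            (if s j = sstar j then τ * z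
              else τ * fieldTr q t (z * (s j - sstar j)) / (s j - sstar j)) * f s := by
  have hq2 : 2 ≤ q := hq.two_le
  have hpos : 1 ≤ q ^ (t - 1) := Nat.one_le_pow _ _ (by omega)
  have heval (y : K) : (if y = sstar j then τ * z
      else τ * fieldTr q t (z * (y - sstar j)) / (y - sstar j))
      = τ * (fieldTrQuotient q t z (sstar j)).eval y := by
    split_ifs with h
    · rw [h, eval_fieldTrQuotient_self hq2 ht]
    · rw [eval_fieldTrQuotient_of_ne (by omega) z h, mul_div_assoc]
  simp only [heval]
  set P := fieldTrQuotient q t z (sstar j) with hPdef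
  have htotal : ∑ s ∈ Fintype.piFinset S, lagrangeCoeff S s * (τ * P.eval (s j)) * f s = 0 := by
    induction hf using Submodule.span_induction with
    | mem g hg =>
      obtain ⟨a, ha, rfl⟩ := hg
      have h := sum_lagrangeCoeff_mul_eval_mul_prod_pow_eq_zero S j P a (by
        by_contra! hcon
        have hP : P.natDegree ≤ q ^ (t - 1) - 1 := natDegree_fieldTrQuotient_le (by omega) _ _
        have hbj := hbox a ha j
        refine hAL a ha ⟨by omega, by omega, fun i hi => ?_⟩
        have := hcon.1 i hi
        have := hbox a ha i
        omega)
      rw [← mul_zero τ, ← h, Finset.mul_sum]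
      exact Finset.sum_congr rfl fun s _ => by ring
    | zero => simp
    | add g h _ _ hg hh => simp [mul_add, Finset.sum_add_distrib, hg, hh]
    | smul c g _ hg =>
      rw [← mul_zero c, ← hg, Finset.mul_sum]
      exact Finset.sum_congr rfl fun s _ => by simp only [Pi.smul_apply, smul_eq_mul]; ring
  have hne : sstar ≠ sprime := fun h => hjne (congrFun h j)
  have hsub : {sstar, sprime} ⊆ Fintype.piFinset S := by
    simp [Finset.insert_subset_iff, hsstar, hsprime, -Fintype.mem_piFinset]
  rw [← Finset.sum_sdiff hsub, Finset.sum_pair hne, hPdef,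
    eval_fieldTrQuotient_self hq2 ht, eval_fieldTrQuotient_of_ne (by omega) z hjne.symm, hz] at htotal
  linear_combination htotal
end
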